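/- Let d be a positive integer, let a ∈ ℝ^d with ‖a‖_{ℓ1} = 1, let c₀, c₁ > 0, and let g : ℝ → ℝ be differentiable on [−1,1] with |g(t₁) − g(t₂)| ≤ c₀|t₁ − t₂| and |g′(t₁) − g′(t₂)| ≤ c₁|t₁ − t₂| for all t₁, t₂ ∈ [−1,1], and with g′(0) > 0. Let 0 < h ≤ 1 satisfy g′(0) − c₁h > 0. Define f : [−1,1]^d → ℝ by f(x) = g(⟨a,x⟩), define ã ∈ ℝ^d by ã_i = (g(h a_i) − g(0))/h, set â = ã/‖ã‖_{ℓ1}, ĝ(t) = g(t·⟨a, sign(â)⟩), and f̂(x) = ĝ(⟨â,x⟩). Then sup_{x ∈ [−1,1]^d} |f(x) − f̂(x)| ≤ 2c₀‖â − a‖_{ℓ1} ≤ 4c₀c₁h/(g′(0) − c₁h). -/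

import Mathlib

/-- Hölder's inequality between `ℓ¹` and `ℓ^∞` for finite sums. -/
lemma abs_sum_mul_le_sum_abs {ι : Type*} [Fintype ι] (u x : ι → ℝ) (hx : ∀ i, |x i| ≤ 1) :
    |∑ i, u i * x i| ≤ ∑ i, |u i| := by
  refine (Finset.abs_sum_le_sum_abs _ _).trans (Finset.sum_le_sum fun i _ => ?_)
  rw [abs_mul]
  exact mul_le_of_le_one_right (abs_nonneg _) (hx i)

lemma Real.abs_sign_le_one (r : ℝ) : |Real.sign r| ≤ 1 := by
  rcases Real.sign_apply_eq r with h | h | h <;> simp [h]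

lemma Real.self_mul_sign (r : ℝ) : r * Real.sign r = |r| := by
  rcases lt_trichotomy r 0 with h | h | h
  · simp [Real.sign_of_neg h, abs_of_neg h]
  · simp [h]
  · simp [Real.sign_of_pos h, abs_of_pos h]

/-- First-order Taylor bound for a function with Lipschitz derivative on `[-1, 1]`. -/
lemma abs_sub_sub_deriv_mul_le {g g' : ℝ → ℝ} {c h t : ℝ}
    (hg : ∀ t ∈ Set.Icc (-1 : ℝ) 1, HasDerivWithinAt g (g' t) (Set.Icc (-1 : ℝ) 1) t)
    (hg' : ∀ t₁ ∈ Set.Icc (-1 : ℝ) 1, ∀ t₂ ∈ Set.Icc (-1 : ℝ) 1,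
      |g' t₁ - g' t₂| ≤ c * |t₁ - t₂|)
    (hc : 0 ≤ c) (hh1 : h ≤ 1) (ht : |t| ≤ h) :
    |g t - g 0 - g' 0 * t| ≤ c * h * |t| := by
  have hh0 : 0 ≤ h := (abs_nonneg t).trans ht
  have hsub : Set.Icc (-h) h ⊆ Set.Icc (-1 : ℝ) 1 := Set.Icc_subset_Icc (by linarith) hh1
  have key := Convex.norm_image_sub_le_of_norm_hasDerivWithin_le
    (f := fun s => g s - g' 0 * s) (f' := fun s => g' s - g' 0 * 1) (s := Set.Icc (-h) h)
    (C := c * h) (x := 0) (y := t)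
    (fun s hs => ((hg s (hsub hs)).mono hsub).sub ((hasDerivWithinAt_id s _).const_mul (g' 0)))
    (fun s hs => by
      have h1 := hg' s (hsub hs) 0 (by simp)
      rw [sub_zero] at h1
      rw [mul_one, Real.norm_eq_abs]
      exact h1.trans (mul_le_mul_of_nonneg_left (abs_le.2 hs) hc))
    (convex_Icc _ _) ⟨by linarith, hh0⟩ (abs_le.1 ht)
  simp only [Real.norm_eq_abs, mul_zero, sub_zero] at key
  rwa [sub_right_comm]

/-- `ℓ¹`-normalising an approximation of a multiple of the `ℓ¹`-unit vector `a`. -/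
lemma sum_abs_normalize_sub_le {ι : Type*} [Fintype ι] {a b : ι → ℝ} {m ε : ℝ}
    (ha : ∑ i, |a i| = 1) (hm : 0 ≤ m) (hε : ε < m) (hb : ∑ i, |b i - m * a i| ≤ ε) :
    0 < ∑ i, |b i| ∧ ∑ i, |b i / (∑ j, |b j|) - a i| ≤ 2 * ε / (m - ε) := by
  set S := ∑ j, |b j| with hS
  have hma : ∑ i, |m * a i| = m := by
    simp only [abs_mul, ← Finset.mul_sum, ha, abs_of_nonneg hm, mul_one]
  have hdiff : |m - S| ≤ ε := by
    rw [← hma, hS, ← Finset.sum_sub_distrib]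
    refine (Finset.abs_sum_le_sum_abs _ _).trans (le_trans ?_ hb)
    refine Finset.sum_le_sum fun i _ => ?_
    rw [abs_sub_comm (b i)]
    exact abs_abs_sub_abs_le_abs_sub _ _
  have hSle : m - ε ≤ S := by linarith [(abs_le.1 hdiff).2]
  have hSpos : 0 < S := by linarith
  have hε0 : 0 ≤ ε := (abs_nonneg _).trans hdiff
  refine ⟨hSpos, ?_⟩
  have hterm : ∀ i, |b i / S - a i| ≤ (|b i - m * a i| + |m - S| * |a i|) / S := fun i => by
    have : b i / S - a i = ((b i - m * a i) + (m - S) * a i) / S := by field_simp; ring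
    rw [this, abs_div, abs_of_pos hSpos, ← abs_mul]
    gcongr
    exact abs_add_le _ _
  calc ∑ i, |b i / S - a i| ≤ ∑ i, (|b i - m * a i| + |m - S| * |a i|) / S :=
        Finset.sum_le_sum fun i _ => hterm i
    _ = (∑ i, |b i - m * a i| + |m - S|) / S := by
        rw [← Finset.sum_div, Finset.sum_add_distrib, ← Finset.mul_sum, ha, mul_one]
    _ ≤ 2 * ε / S := by gcongr; linarith
    _ ≤ 2 * ε / (m - ε) := by
        have : 0 < m - ε := by linarith
        gcongr

theorem stmt_7 (d : ℕ) (hd : 0 < d) (a : Fin d → ℝ) (ha : ∑ i, |a i| = 1)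
    (c₀ c₁ : ℝ) (hc₀ : 0 < c₀) (hc₁ : 0 < c₁)
    (g g' : ℝ → ℝ)
    (hg : ∀ t ∈ Set.Icc (-1 : ℝ) 1, HasDerivWithinAt g (g' t) (Set.Icc (-1 : ℝ) 1) t)
    (hglip : ∀ t₁ ∈ Set.Icc (-1 : ℝ) 1, ∀ t₂ ∈ Set.Icc (-1 : ℝ) 1,
      |g t₁ - g t₂| ≤ c₀ * |t₁ - t₂|)
    (hg'lip : ∀ t₁ ∈ Set.Icc (-1 : ℝ) 1, ∀ t₂ ∈ Set.Icc (-1 : ℝ) 1,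
      |g' t₁ - g' t₂| ≤ c₁ * |t₁ - t₂|)
    (hg'0 : 0 < g' 0)
    (h : ℝ) (hh0 : 0 < h) (hh1 : h ≤ 1) (hpos : 0 < g' 0 - c₁ * h)
    (f : (Fin d → ℝ) → ℝ) (hf : ∀ x, f x = g (∑ i, a i * x i))
    (at' : Fin d → ℝ) (hat : ∀ i, at' i = (g (h * a i) - g 0) / h)
    (ah : Fin d → ℝ) (hah : ∀ i, ah i = at' i / ∑ j, |at' j|)
    (gh : ℝ → ℝ) (hgh : ∀ t, gh t = g (t * ∑ i, a i * Real.sign (ah i)))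
    (fh : (Fin d → ℝ) → ℝ) (hfh : ∀ x, fh x = gh (∑ i, ah i * x i)) :
    (∀ x : Fin d → ℝ, (∀ i, |x i| ≤ 1) →
        |f x - fh x| ≤ 2 * c₀ * ∑ i, |ah i - a i|) ∧
      2 * c₀ * (∑ i, |ah i - a i|) ≤ 4 * c₀ * c₁ * h / (g' 0 - c₁ * h) := by
  have hai : ∀ i, |a i| ≤ 1 := fun i =>
    ha ▸ Finset.single_le_sum (f := fun i => |a i|) (fun _ _ => abs_nonneg _) (Finset.mem_univ i)
  have happrox : ∑ i, |at' i - g' 0 * a i| ≤ c₁ * h := by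
    have hterm : ∀ i, |at' i - g' 0 * a i| ≤ c₁ * h * |a i| := fun i => by
      have habs : |h * a i| = h * |a i| := by rw [abs_mul, abs_of_pos hh0]
      have key := abs_sub_sub_deriv_mul_le (t := h * a i) hg hg'lip hc₁.le hh1
        (habs.trans_le (mul_le_of_le_one_right hh0.le (hai i)))
      have : at' i - g' 0 * a i = (g (h * a i) - g 0 - g' 0 * (h * a i)) / h := by
        rw [hat]; field_simp
      rw [this, abs_div, abs_of_pos hh0, div_le_iff₀ hh0]
      rw [habs] at key
      linarith
    refine (Finset.sum_le_sum fun i _ => hterm i).trans_eq ?_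
    rw [← Finset.mul_sum, ha, mul_one]
  obtain ⟨hSpos, hbound⟩ := sum_abs_normalize_sub_le ha hg'0.le (sub_pos.1 hpos) happrox
  simp only [← hah] at hbound
  have hah1 : ∑ i, |ah i| = 1 := by
    simp only [hah, abs_div, abs_of_pos hSpos]
    rw [← Finset.sum_div, div_self hSpos.ne']
  refine ⟨fun x hx => ?_, ?_⟩
  · have hsign : ∀ i, |Real.sign (ah i)| ≤ 1 := fun i => Real.abs_sign_le_one _
    have hax := (abs_sum_mul_le_sum_abs a x hx).trans_eq ha
    have hahx := (abs_sum_mul_le_sum_abs ah x hx).trans_eq hah1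
    have has := (abs_sum_mul_le_sum_abs a _ hsign).trans_eq ha
    have hdx := abs_sum_mul_le_sum_abs (fun i => ah i - a i) x hx
    have hds := abs_sum_mul_le_sum_abs (fun i => ah i - a i) _ hsign
    simp only [sub_mul, Finset.sum_sub_distrib, Real.self_mul_sign, hah1] at hdx hds
    rw [hf, hfh, hgh]
    set p := ∑ i, a i * x i
    set q := ∑ i, ah i * x i
    set s := ∑ i, a i * Real.sign (ah i)
    have hqs : |q * s| ≤ 1 := by
      rw [abs_mul]
      exact mul_le_one₀ hahx (abs_nonneg _) has
    refine (hglip p (abs_le.1 hax) (q * s) (abs_le.1 hqs)).trans ?_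
    have hsplit : |p - q * s| ≤ |q - p| + |q| * |1 - s| := by
      rw [abs_sub_comm q p, ← abs_mul]
      refine (congrArg abs ?_).trans_le (abs_add_le (p - q) (q * (1 - s)))
      ring
    have hlast := mul_le_of_le_one_left (abs_nonneg (1 - s)) hahx
    rw [mul_comm 2 c₀, mul_assoc]
    gcongr
    linarith
  · calc 2 * c₀ * ∑ i, |ah i - a i| ≤ 2 * c₀ * (2 * (c₁ * h) / (g' 0 - c₁ * h)) := by gcongr
      _ = 4 * c₀ * c₁ * h / (g' 0 - c₁ * h) := by ring
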